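/- Gauss' measure γ, defined by dγ(x) = (1/log 2) · dx/(x+1) on [0,1], is invariant under the Gauss map τ₁: for every measurable set E ⊆ [0,1], γ(τ₁⁻¹(E)) = γ(E). -/

import Mathlib

open Real MeasureTheory

/-- The Gauss map τ₁(x) = 1/x - ⌊1/x⌋, with τ₁(0) = 0. -/
noncomputable def gaussMap (x : ℝ) : ℝ := if x = 0 then 0 else 1 / x - ⌊1 / x⌋

/-- Gauss' measure on [0,1]: dγ(x) = (1/log 2) dx/(x+1). -/
noncomputable def gaussMeasure : Measure ℝ :=
  (volume.restrict (Set.Icc (0:ℝ) 1)).withDensity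
    (fun x => ENNReal.ofReal ((Real.log 2)⁻¹ / (x + 1)))

open Set Filter Topology

/-- The Gauss measure of an arbitrary set, up to the null set `{0}`. -/
lemma gaussMeasure_apply_Ioc (s : Set ℝ) :
    gaussMeasure s =
      ∫⁻ x in s ∩ Ioc 0 1, ENNReal.ofReal ((Real.log 2)⁻¹ / (x + 1)) := by
  rw [gaussMeasure, withDensity_apply', ← restrict_Ioc_eq_restrict_Icc,
    Measure.restrict_restrict' measurableSet_Ioc]

/-- The Gauss measure of an arbitrary set, up to the null set `{1}`. -/
lemma gaussMeasure_apply_Ico (s : Set ℝ) :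
    gaussMeasure s =
      ∫⁻ x in s ∩ Ico 0 1, ENNReal.ofReal ((Real.log 2)⁻¹ / (x + 1)) := by
  rw [gaussMeasure, withDensity_apply', ← restrict_Ico_eq_restrict_Icc,
    Measure.restrict_restrict' measurableSet_Ico]

/-- On `(0, 1]`, preimages under the Gauss map are unions of images under the inverse branches
`y ↦ 1 / (y + n + 1)`. -/
lemma gaussMap_preimage_inter_Ioc (s : Set ℝ) :
    gaussMap ⁻¹' s ∩ Ioc 0 1 = ⋃ n : ℕ, (fun y : ℝ => (y + n + 1)⁻¹) '' (s ∩ Ico 0 1) := by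
  ext x
  simp only [mem_inter_iff, mem_preimage, mem_iUnion, mem_image]
  constructor
  · rintro ⟨hs, hx0, hx1⟩
    rw [gaussMap, if_neg hx0.ne'] at hs
    have h1 : 1 ≤ 1 / x := (one_le_div hx0).2 hx1
    have hfloor : (1 : ℤ) ≤ ⌊1 / x⌋ := Int.le_floor.2 (by exact_mod_cast h1)
    obtain ⟨n, hn⟩ := Int.eq_ofNat_of_zero_le (sub_nonneg.2 hfloor)
    have hn' : (⌊1 / x⌋ : ℝ) = n + 1 := by
      have : ⌊1 / x⌋ = n + 1 := by omega
      rw [this]; push_cast; ring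
    refine ⟨n, 1 / x - ⌊1 / x⌋, ⟨hs, ?_, ?_⟩, ?_⟩
    · linarith [Int.floor_le (1 / x)]
    · linarith [Int.lt_floor_add_one (1 / x)]
    · rw [hn', show 1 / x - (n + 1) + n + 1 = x⁻¹ by ring, inv_inv]
  · rintro ⟨n, y, ⟨hs, hy0, hy1⟩, rfl⟩
    have hn : (0 : ℝ) ≤ n := n.cast_nonneg
    have hpos : 0 < y + n + 1 := by linarith
    have hfloor : ⌊y + n + 1⌋ = (n : ℤ) + 1 := by
      rw [Int.floor_eq_iff]
      push_cast
      constructor <;> linarith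
    refine ⟨?_, inv_pos.2 hpos, inv_le_one_of_one_le₀ (by linarith)⟩
    rw [gaussMap, if_neg (inv_pos.2 hpos).ne', one_div, inv_inv, hfloor]
    convert hs using 1
    push_cast
    ring

/-- Images of subsets of `[0, 1)` under distinct inverse branches of the Gauss map are disjoint. -/
lemma pairwise_disjoint_image_inv_add (s : Set ℝ) :
    Pairwise (Function.onFun Disjoint
      fun n : ℕ => (fun y : ℝ => (y + n + 1)⁻¹) '' (s ∩ Ico 0 1)) := by
  intro m n hmn
  rw [Function.onFun, Set.disjoint_left]
  rintro _ ⟨y, ⟨-, hy0, hy1⟩, rfl⟩ ⟨z, ⟨-, hz0, hz1⟩, h⟩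
  have h' : z + n + 1 = y + m + 1 := inv_injective h
  apply hmn
  have h1 : (m : ℝ) < n + 1 := by linarith
  have h2 : (n : ℝ) < m + 1 := by linarith
  norm_cast at h1 h2
  omega

/-- The telescoping series `∑ 1 / ((x + n + 1) (x + n + 2)) = 1 / (x + 1)`. -/
lemma hasSum_inv_mul_inv_succ {x : ℝ} (hx : 0 ≤ x) :
    HasSum (fun n : ℕ => (x + n + 1)⁻¹ * (x + n + 2)⁻¹) (x + 1)⁻¹ := by
  rw [hasSum_iff_tendsto_nat_of_nonneg (fun n => by positivity)]
  have hsum (N : ℕ) : ∑ n ∈ Finset.range N, (x + n + 1)⁻¹ * (x + n + 2)⁻¹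
      = (x + 1)⁻¹ - (x + 1 + N)⁻¹ := by
    induction N with
    | zero => simp
    | succ k ih =>
      have h1 : x + k + 1 ≠ 0 := by positivity
      have h2 : x + k + 2 ≠ 0 := by positivity
      rw [Finset.sum_range_succ, ih, Nat.cast_succ, show x + 1 + (k : ℝ) = x + k + 1 by ring,
        show x + 1 + ((k : ℝ) + 1) = x + k + 2 by ring]
      have h3 : (x + k + 1)⁻¹ * (x + k + 2)⁻¹ = (x + k + 1)⁻¹ - (x + k + 2)⁻¹ := by
        field_simp
        ring
      rw [h3]
      ring
  simp_rw [hsum]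
  simpa using tendsto_const_nhds.sub
    (tendsto_inv_atTop_zero.comp
      (tendsto_atTop_add_const_left _ (x + 1) tendsto_natCast_atTop_atTop))

/-- The Gauss density is fixed by the transfer operator of the Gauss map. -/
lemma tsum_transfer_gauss_density {x c : ℝ} (hx : 0 ≤ x) (hc : 0 ≤ c) :
    ∑' n : ℕ, ENNReal.ofReal |-1 / (x + n + 1) ^ 2| *
        ENNReal.ofReal (c / ((x + n + 1)⁻¹ + 1)) = ENNReal.ofReal (c / (x + 1)) := by
  have hterm (n : ℕ) : ENNReal.ofReal |-1 / (x + n + 1) ^ 2| *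
      ENNReal.ofReal (c / ((x + n + 1)⁻¹ + 1))
        = ENNReal.ofReal (c * ((x + n + 1)⁻¹ * (x + n + 2)⁻¹)) := by
    rw [← ENNReal.ofReal_mul (abs_nonneg _), abs_div, abs_neg, abs_one,
      abs_of_nonneg (by positivity : (0 : ℝ) ≤ (x + n + 1) ^ 2)]
    have h1 : x + n + 1 ≠ 0 := by positivity
    have h2 : x + n + 2 ≠ 0 := by positivity
    have h3 : (x + n + 1)⁻¹ + 1 = (x + n + 2) / (x + n + 1) := by
      field_simp
      ring
    rw [h3]
    congr 1
    field_simp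
  have h := (hasSum_inv_mul_inv_succ hx).mul_left c
  simp_rw [hterm]
  rw [← ENNReal.ofReal_tsum_of_nonneg (fun n => by positivity) h.summable, h.tsum_eq,
    div_eq_mul_inv]

theorem gaussMeasure_invariant (E : Set ℝ) (hE : MeasurableSet E)
    (hE1 : E ⊆ Set.Icc (0:ℝ) 1) :
    gaussMeasure (gaussMap ⁻¹' E) = gaussMeasure E := by
  have hmeas : MeasurableSet (E ∩ Ico 0 1) := hE.inter measurableSet_Ico
  have hderiv (n : ℕ) : ∀ x ∈ E ∩ Ico 0 1, HasDerivWithinAt (fun y : ℝ => (y + n + 1)⁻¹)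
      (-1 / (x + n + 1) ^ 2) (E ∩ Ico 0 1) x := by
    rintro x ⟨-, hx0, -⟩
    have hne : x + n + 1 ≠ 0 := by positivity
    exact ((((hasDerivAt_id x).add_const (n : ℝ)).add_const 1).fun_inv hne).hasDerivWithinAt
  have hinj (n : ℕ) : InjOn (fun y : ℝ => (y + n + 1)⁻¹) (E ∩ Ico 0 1) := by
    intro y _ z _ h
    simpa using h
  have himage (n : ℕ) : MeasurableSet ((fun y : ℝ => (y + n + 1)⁻¹) '' (E ∩ Ico 0 1)) :=
    hmeas.image_of_measurable_injOn (by fun_prop) (hinj n)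
  rw [gaussMeasure_apply_Ioc, gaussMeasure_apply_Ico, gaussMap_preimage_inter_Ioc,
    lintegral_iUnion himage (pairwise_disjoint_image_inv_add E)]
  simp_rw [fun n => lintegral_image_eq_lintegral_abs_deriv_mul hmeas (hderiv n) (hinj n)]
  rw [← lintegral_tsum (fun n => by fun_prop)]
  refine setLIntegral_congr_fun hmeas fun x hx => ?_
  exact tsum_transfer_gauss_density hx.2.1 (by positivity)
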